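/- Let p_g be the Gaussian density with mean m_g ∈ ℝ and variance V_g > 0, and consider the uncontaminated case ε = 0, so that p_c = p_g. Then the system G(m_g, α, σ, 0) = 0 and H(m_g, α, σ, 0) = 0 has no solution (α, σ) ∈ (0,∞) × (0,∞); that is, with purely Gaussian data the GCP dynamics has no finite equilibrium in (α, σ), and the equilibrium lies only at infinity (α = σ = ∞), making the predictive distribution Gaussian rather than a proper Student's t. -/

import Mathlib

open MeasureTheory

/-- The digamma function `Ψ(α) = Γ'(α)/Γ(α)`. -/
noncomputable def digamma (x : ℝ) : ℝ := deriv Real.Gamma x / Real.Gamma x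

/-- The Gaussian density with mean `m` and variance `v`. -/
noncomputable def gaussianPDF (m v y : ℝ) : ℝ :=
  Real.exp (-((y - m) ^ 2) / (2 * v)) / Real.sqrt (2 * Real.pi * v)

lemma integrable_exp_neg_mul_log_one_add_sq_div {s p : ℝ} (hs : 0 < s) (hp : 1 / 2 < p) :
    Integrable fun z : ℝ => Real.exp (-(p * Real.log (1 + z ^ 2 / s))) := by
  have h := (integrable_rpow_neg_one_add_norm_sq (E := ℝ) (μ := volume) (r := 2 * p)
    (by simp; linarith)).comp_div (Real.sqrt_pos.2 hs).ne'
  refine h.congr (.of_forall fun z => ?_)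
  have h1 : 0 < 1 + z ^ 2 / s := by positivity
  simp only [Real.norm_eq_abs, sq_abs, div_pow, Real.sq_sqrt hs.le]
  rw [Real.rpow_def_of_pos h1]
  ring_nf

lemma continuous_log_one_add_sq_div {s : ℝ} (hs : 0 < s) :
    Continuous fun z : ℝ => Real.log (1 + z ^ 2 / s) :=
  Continuous.log (by fun_prop) fun z => by positivity

lemma log_one_add_sq_div_nonneg {s : ℝ} (hs : 0 < s) (z : ℝ) :
    0 ≤ Real.log (1 + z ^ 2 / s) :=
  Real.log_nonneg (by have : 0 ≤ z ^ 2 / s := by positivity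
                      linarith)

lemma integral_exp_neg_mul_log_one_add_sq_div {s p : ℝ} (hs : 0 < s) (hp : 1 / 2 < p) :
    ∫ z : ℝ, Real.exp (-(p * Real.log (1 + z ^ 2 / s))) =
      √(Real.pi * s) * (Real.Gamma (p - 1 / 2) / Real.Gamma p) := by
  let f : ℝ → ℝ → ℝ := fun t z => t ^ (p - 1) * Real.exp (-((1 + z ^ 2 / s) * t))
  have hf : ∀ t z, f t z = t ^ (p - 1) * Real.exp (-t) * Real.exp (-(t / s) * z ^ 2) := by
    intro t z
    simp only [f]
    rw [mul_assoc, ← Real.exp_add]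
    ring_nf
  have hinner : ∀ t ∈ Set.Ioi (0 : ℝ),
      ∫ z, f t z = √(Real.pi * s) * (Real.exp (-t) * t ^ (p - 1 / 2 - 1)) := by
    intro t ht
    have ht : 0 < t := ht
    simp only [hf]
    rw [integral_const_mul, integral_gaussian,
      show Real.pi / (t / s) = Real.pi * s / t by field_simp, Real.sqrt_div (by positivity),
      show p - 1 / 2 - 1 = (p - 1) - 1 / 2 by ring, Real.rpow_sub ht (p - 1), ← Real.sqrt_eq_rpow]
    ring
  have hint : Integrable (Function.uncurry f) ((volume.restrict (Set.Ioi 0)).prod volume) := by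
    rw [integrable_prod_iff (by
      apply Measurable.aestronglyMeasurable
      simp only [f, Function.uncurry_def]
      fun_prop)]
    constructor
    · filter_upwards [ae_restrict_mem measurableSet_Ioi] with t ht
      simp only [Function.uncurry_apply_pair, hf]
      exact (integrable_exp_neg_mul_sq (div_pos ht hs)).const_mul _
    · have h := (Real.GammaIntegral_convergent (s := p - 1 / 2) (by linarith)).const_mul
        √(Real.pi * s)
      refine h.congr ?_
      filter_upwards [ae_restrict_mem measurableSet_Ioi] with t ht
      rw [← hinner t ht]
      refine integral_congr_ae (.of_forall fun z => ?_)
      have ht : 0 < t := ht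
      have : 0 ≤ f t z := by simp only [f]; positivity
      simp [abs_of_nonneg this]
  have hswap := integral_integral_swap hint
  rw [setIntegral_congr_fun measurableSet_Ioi hinner, integral_const_mul,
    ← Real.Gamma_eq_integral (by linarith)] at hswap
  have houter : ∀ z, ∫ t in Set.Ioi (0 : ℝ), f t z =
      Real.exp (-(p * Real.log (1 + z ^ 2 / s))) * Real.Gamma p := by
    intro z
    have h1 : 0 < 1 + z ^ 2 / s := by positivity
    simp only [f]
    rw [Real.integral_rpow_mul_exp_neg_mul_Ioi (by linarith) h1,
      Real.rpow_def_of_pos (by positivity), one_div, Real.log_inv]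
    ring_nf
  simp only [houter] at hswap
  rw [integral_mul_const] at hswap
  have hG : Real.Gamma p ≠ 0 := (Real.Gamma_pos_of_pos (by linarith)).ne'
  rw [← mul_div_assoc, eq_div_iff hG, hswap]

lemma integrable_log_one_add_sq_div_mul_exp {s p : ℝ} (hs : 0 < s) (hp : 1 / 2 < p) :
    Integrable fun z : ℝ => Real.log (1 + z ^ 2 / s) *
      Real.exp (-(p * Real.log (1 + z ^ 2 / s))) := by
  set d := (p - 1 / 2) / 2 with hd
  have hd0 : 0 < d := by linarith
  have hc := continuous_log_one_add_sq_div hs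
  refine ((integrable_exp_neg_mul_log_one_add_sq_div hs
    (show 1 / 2 < p - d by linarith)).const_mul d⁻¹).mono' (by fun_prop) (.of_forall fun z => ?_)
  have hl := log_one_add_sq_div_nonneg hs z
  set l := Real.log (1 + z ^ 2 / s)
  rw [Real.norm_eq_abs, abs_of_nonneg (by positivity)]
  have h1 : d * l ≤ Real.exp (d * l) := by linarith [Real.add_one_le_exp (d * l)]
  rw [show -((p - d) * l) = d * l + -(p * l) by ring, Real.exp_add, ← mul_assoc]
  gcongr
  rwa [← div_eq_inv_mul, le_div_iff₀' hd0]

lemma integral_log_one_add_sq_div_mul_exp {s a : ℝ} (hs : 0 < s) (ha : 0 < a) :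
    ∫ z : ℝ, Real.log (1 + z ^ 2 / s) *
        Real.exp (-((a + 1 / 2) * Real.log (1 + z ^ 2 / s))) =
      (digamma (a + 1 / 2) - digamma a) *
        ∫ z : ℝ, Real.exp (-((a + 1 / 2) * Real.log (1 + z ^ 2 / s))) := by
  have hc := continuous_log_one_add_sq_div hs
  have hderiv := (hasDerivAt_integral_of_dominated_loc_of_deriv_le (μ := (volume : Measure ℝ))
    (F := fun b z => Real.exp (-((b + 1 / 2) * Real.log (1 + z ^ 2 / s))))
    (F' := fun b z => -(Real.log (1 + z ^ 2 / s) *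
      Real.exp (-((b + 1 / 2) * Real.log (1 + z ^ 2 / s)))))
    (bound := fun z => Real.log (1 + z ^ 2 / s) *
      Real.exp (-((a / 2 + 1 / 2) * Real.log (1 + z ^ 2 / s))))
    (x₀ := a) (s := Set.Ioi (a / 2)) (Ioi_mem_nhds (by linarith))
    (.of_forall fun b => Continuous.aestronglyMeasurable (by fun_prop))
    (integrable_exp_neg_mul_log_one_add_sq_div hs (by linarith)) (by fun_prop)
    (.of_forall fun z b hb => by
      have hl := log_one_add_sq_div_nonneg hs z
      have hb : a / 2 < b := hb
      rw [norm_neg, Real.norm_eq_abs, abs_of_nonneg (by positivity)]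
      gcongr)
    (integrable_log_one_add_sq_div_mul_exp hs (by linarith))
    (.of_forall fun z b _ => by
      have h := ((((hasDerivAt_id b).add_const (1 / 2)).mul_const
        (Real.log (1 + z ^ 2 / s))).neg).exp
      refine h.congr_deriv ?_
      simp
      ring)).2
  have hdiff : ∀ x : ℝ, 0 < x → HasDerivAt Real.Gamma (deriv Real.Gamma x) x := fun x hx =>
    (Real.differentiableAt_Gamma fun m => by
      have : (0 : ℝ) ≤ m := m.cast_nonneg
      linarith).hasDerivAt
  have hG : Real.Gamma a ≠ 0 := (Real.Gamma_pos_of_pos ha).ne'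
  have hG' : Real.Gamma (a + 1 / 2) ≠ 0 := (Real.Gamma_pos_of_pos (by linarith)).ne'
  have hform := (((hdiff a ha).div ((hdiff (a + 1 / 2) (by linarith)).comp_add_const a (1 / 2))
    hG').const_mul √(Real.pi * s))
  have heq := hderiv.unique (hform.congr_of_eventuallyEq (by
    filter_upwards [Ioi_mem_nhds ha] with b hb
    have hb : 0 < b := hb
    rw [integral_exp_neg_mul_log_one_add_sq_div hs (by linarith)]
    simp))
  rw [integral_neg] at heq
  rw [integral_exp_neg_mul_log_one_add_sq_div hs (by linarith), ← neg_inj, heq]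
  simp only [digamma, add_sub_cancel_right]
  field_simp
  ring

/-- On a bounded interval `exp (-l)` lies below a suitable line, and off the interval above it. -/
lemma exists_affine_separating_exp_neg {S : Set ℝ} (hS : S.OrdConnected) (hb : BddBelow S)
    (ha : BddAbove S) :
    ∃ A B : ℝ, (∀ l ∈ S, Real.exp (-l) ≤ A + B * l) ∧ ∀ l ∉ S, A + B * l ≤ Real.exp (-l) := by
  rcases S.eq_empty_or_nonempty with rfl | hne
  · exact ⟨0, 0, by simp, fun l _ => by simpa using (Real.exp_pos (-l)).le⟩
  have hmem : ∀ l ∈ S, sInf S ≤ l ∧ l ≤ sSup S := fun l hl => ⟨csInf_le hb hl, le_csSup ha hl⟩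
  have hout : ∀ l ∉ S, l ≤ sInf S ∨ sSup S ≤ l := by
    intro l hl
    by_contra! h
    obtain ⟨x, hx, hxl⟩ := exists_lt_of_csInf_lt hne h.1
    obtain ⟨y, hy, hly⟩ := exists_lt_of_lt_csSup hne h.2
    exact hl (hS.out hx hy ⟨hxl.le, hly.le⟩)
  set a := sInf S
  set b := sSup S
  have hab : a ≤ b := by
    obtain ⟨x, hx⟩ := hne
    exact (hmem x hx).1.trans (hmem x hx).2
  rcases hab.eq_or_lt with hab | hab
  · refine ⟨Real.exp (-a) * (1 + a), -Real.exp (-a), fun l hl => ?_, fun l _ => ?_⟩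
    · have : l = a := le_antisymm (hab ▸ (hmem l hl).2) (hmem l hl).1
      rw [this]
      linarith
    · have h := mul_le_mul_of_nonneg_left (Real.add_one_le_exp (a - l)) (Real.exp_pos (-a)).le
      rw [← Real.exp_add, show -a + (a - l) = -l by ring] at h
      linarith
  have hconv : ConvexOn ℝ Set.univ fun l : ℝ => Real.exp (-l) := by
    simpa using! convexOn_exp.comp_linearMap (-LinearMap.id : ℝ →ₗ[ℝ] ℝ)
  set m := (Real.exp (-b) - Real.exp (-a)) / (b - a) with hm
  have hmb : m * (b - a) = Real.exp (-b) - Real.exp (-a) :=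
    div_mul_cancel₀ _ (sub_pos.2 hab).ne'
  refine ⟨Real.exp (-a) - m * a, m, fun l hl => ?_, fun l hl => ?_⟩
  · obtain ⟨h1, h2⟩ := hmem l hl
    rcases h1.eq_or_lt with rfl | h1
    · linarith
    have h := hconv.secant_mono (a := a) (x := l) (y := b) trivial trivial trivial h1.ne' hab.ne' h2
    rw [div_le_iff₀ (by linarith)] at h
    linarith
  · rcases hout l hl with h1 | h1
    · rcases h1.eq_or_lt with rfl | h1
      · linarith
      have h := hconv.slope_mono_adjacent (x := l) (y := a) (z := b) trivial trivial h1 hab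
      rw [div_le_iff₀ (by linarith)] at h
      linarith
    · rcases h1.eq_or_lt with rfl | h1
      · linarith
      have h := hconv.slope_mono_adjacent (x := a) (y := b) (z := l) trivial trivial hab h1
      rw [le_div_iff₀ (by linarith)] at h
      linarith

lemma not_eventually_affine_eq_exp_neg (A B : ℝ) :
    ¬∀ᶠ l in Filter.atTop, A + B * l = Real.exp (-l) := by
  intro h
  obtain ⟨l, hl⟩ := Filter.eventually_atTop.1 h
  have h0 := hl l le_rfl
  have h1 := hl (l + 1) (by linarith)
  have h2 := hl (l + 2) (by linarith)
  rw [neg_add, Real.exp_add] at h1 h2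
  rw [show (-2 : ℝ) = -1 + -1 by norm_num, Real.exp_add] at h2
  have hq : Real.exp (-1) < 1 := by simp
  have : Real.exp (-l) * (1 - Real.exp (-1)) ^ 2 = 0 := by linear_combination 2 * h1 - h0 - h2
  have hpos : 0 < 1 - Real.exp (-1) := by linarith
  have : 0 < Real.exp (-l) * (1 - Real.exp (-1)) ^ 2 := by positivity
  linarith

/-- A Gaussian kernel and a Student kernel cannot agree on the moments of `1`, of
`log (1 + z ^ 2 / s)` and of `(1 + z ^ 2 / s)⁻¹`. -/
lemma gaussian_student_moments_ne {s k p c d : ℝ} (hs : 0 < s) (hk : 0 < k)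
    {g t : ℝ → ℝ} (hg : ∀ z, g z = Real.exp (c - k * z ^ 2))
    (ht : ∀ z, t z = Real.exp (d - p * Real.log (1 + z ^ 2 / s)))
    (ig : Integrable g) (it : Integrable t)
    (igL : Integrable fun z => Real.log (1 + z ^ 2 / s) * g z)
    (itL : Integrable fun z => Real.log (1 + z ^ 2 / s) * t z)
    (igw : Integrable fun z => Real.exp (-Real.log (1 + z ^ 2 / s)) * g z)
    (itw : Integrable fun z => Real.exp (-Real.log (1 + z ^ 2 / s)) * t z)
    (h1 : ∫ z, g z = ∫ z, t z)
    (hL : ∫ z, Real.log (1 + z ^ 2 / s) * g z = ∫ z, Real.log (1 + z ^ 2 / s) * t z)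
    (hw : ∫ z, Real.exp (-Real.log (1 + z ^ 2 / s)) * g z =
      ∫ z, Real.exp (-Real.log (1 + z ^ 2 / s)) * t z) : False := by
  let ρ : ℝ → ℝ := fun l => c - k * s * (Real.exp l - 1) - (d - p * l)
  have hks : 0 < k * s := mul_pos hk hs
  have hgρ : ∀ z, g z = Real.exp (ρ (Real.log (1 + z ^ 2 / s)) +
      (d - p * Real.log (1 + z ^ 2 / s))) := by
    intro z
    rw [hg]
    congr 1
    simp only [ρ]
    rw [Real.exp_log (by positivity)]
    field_simp
    ring
  have hlim : ∀ᶠ l in Filter.atTop, ρ l < 0 := by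
    have h := (Real.isLittleO_pow_exp_atTop (n := 1)).const_mul_left p
    have h' : (fun _ : ℝ => c + k * s - d) =o[Filter.atTop] Real.exp := by
      rw [Asymptotics.isLittleO_const_left]
      right
      exact tendsto_norm_atTop_atTop.comp Real.tendsto_exp_atTop
    filter_upwards [(h.add h').def (half_pos hks)] with l hl
    rw [Real.norm_eq_abs, Real.norm_eq_abs, Real.abs_exp, pow_one] at hl
    have := (le_abs_self _).trans hl
    have := mul_pos hks (Real.exp_pos l)
    simp only [ρ]
    linarith
  have hconc : ConcaveOn ℝ Set.univ ρ := by
    refine ⟨convex_univ, fun x _ y _ a b ha hb hab => ?_⟩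
    have h := mul_le_mul_of_nonneg_left (convexOn_exp.2 (Set.mem_univ x) (Set.mem_univ y) ha hb hab)
      hks.le
    simp only [ρ, smul_eq_mul] at h ⊢
    obtain rfl : b = 1 - a := by linarith
    linarith
  let S : Set ℝ := {l | 0 ≤ l ∧ 0 < ρ l}
  have hS : S.OrdConnected := by
    have : Convex ℝ S := (convex_Ici 0).inter (by simpa using! hconc.convex_gt 0)
    exact this.ordConnected
  obtain ⟨M, hM⟩ := Filter.eventually_atTop.1 hlim
  obtain ⟨A, B, hin, hout⟩ := exists_affine_separating_exp_neg hS ⟨0, fun l hl => hl.1⟩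
    ⟨M, fun l hl => by
      by_contra! h
      exact (hM l h.le).not_gt hl.2⟩
  let f : ℝ → ℝ := fun z => (A + B * Real.log (1 + z ^ 2 / s) -
    Real.exp (-Real.log (1 + z ^ 2 / s))) * (g z - t z)
  have hc := continuous_log_one_add_sq_div hs
  have hfc : Continuous f := by
    simp only [f, hg, ht]
    fun_prop
  have hf0 : 0 ≤ f := by
    intro z
    have hl := log_one_add_sq_div_nonneg hs z
    simp only [f, hgρ z, ht z, Pi.zero_apply]
    set l := Real.log (1 + z ^ 2 / s)
    by_cases hlS : l ∈ S
    · refine mul_nonneg (sub_nonneg.2 (hin l hlS)) (sub_nonneg.2 (Real.exp_le_exp.2 ?_))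
      linarith [hlS.2]
    · have hρ : ρ l ≤ 0 := not_lt.1 fun h => hlS ⟨hl, h⟩
      refine mul_nonneg_of_nonpos_of_nonpos (sub_nonpos.2 (hout l hlS))
        (sub_nonpos.2 (Real.exp_le_exp.2 ?_))
      linarith
  have hfsplit : f = fun z => (A * (g z - t z) + B * (Real.log (1 + z ^ 2 / s) * g z -
      Real.log (1 + z ^ 2 / s) * t z)) - (Real.exp (-Real.log (1 + z ^ 2 / s)) * g z -
      Real.exp (-Real.log (1 + z ^ 2 / s)) * t z) := by
    ext z
    simp only [f]
    ring
  have i1 : Integrable fun z => A * (g z - t z) := (ig.sub it).const_mul A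
  have i2 : Integrable fun z => B * (Real.log (1 + z ^ 2 / s) * g z -
      Real.log (1 + z ^ 2 / s) * t z) := (igL.sub itL).const_mul B
  have i3 : Integrable fun z => Real.exp (-Real.log (1 + z ^ 2 / s)) * g z -
      Real.exp (-Real.log (1 + z ^ 2 / s)) * t z := igw.sub itw
  have hfi : Integrable f := hfsplit ▸ (i1.add i2).sub i3
  have hfint : ∫ z, f z = 0 := by
    rw [hfsplit, integral_sub (by exact i1.add i2) i3, integral_add i1 i2, integral_const_mul,
      integral_const_mul, integral_sub ig it, integral_sub igL itL, integral_sub igw itw, h1, hL, hw]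
    ring
  have hfz : f = 0 := (Continuous.ae_eq_iff_eq volume hfc continuous_const).1
    ((integral_eq_zero_iff_of_nonneg hf0 hfi).1 hfint)
  refine not_eventually_affine_eq_exp_neg A B ?_
  filter_upwards [hlim, Filter.eventually_ge_atTop 0] with l hl hl0
  have hz := congrFun hfz √(s * (Real.exp l - 1))
  have hexp : 0 ≤ Real.exp l - 1 := sub_nonneg.2 (Real.one_le_exp hl0)
  have hlog : Real.log (1 + √(s * (Real.exp l - 1)) ^ 2 / s) = l := by
    rw [Real.sq_sqrt (by positivity), mul_div_cancel_left₀ _ hs.ne', add_sub_cancel, Real.log_exp]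
  simp only [f, hgρ, ht, hlog, Pi.zero_apply] at hz
  rcases mul_eq_zero.1 hz with h | h
  · linarith
  · have := Real.exp_injective (sub_eq_zero.1 h)
    linarith

/-- With purely Gaussian data (`ε = 0`, `p_c = p_g = N(m_g, V_g)`), the GCP system
`G(m_g, α, σ, 0) = 0`, `H(m_g, α, σ, 0) = 0` has no finite equilibrium
`(α, σ) ∈ (0,∞) × (0,∞)`: the equilibrium lies only at infinity, so the predictive
distribution stays Gaussian rather than a proper Student's t. -/
theorem gcp_no_finite_equilibrium_for_gaussian_data
    (m_g V_g : ℝ) (hVg : 0 < V_g) :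
    ∀ α σ : ℝ, 0 < α → 0 < σ →
      ¬((∫ y, Real.log (1 + (y - m_g) ^ 2 / (2 * σ)) * gaussianPDF m_g V_g y)
            + digamma α - digamma (α + 1 / 2) = 0 ∧
        (∫ y, (α * (y - m_g) ^ 2 - σ) / (2 * σ + (y - m_g) ^ 2) *
            gaussianPDF m_g V_g y) = 0) := by
  rintro α σ hα hσ ⟨hG, hH⟩
  have hs : 0 < 2 * σ := by positivity
  have hk : 0 < 1 / (2 * V_g) := by positivity
  let g : ℝ → ℝ := fun z => gaussianPDF m_g V_g (z + m_g)
  let L : ℝ → ℝ := fun z => Real.log (1 + z ^ 2 / (2 * σ))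
  have hLc : Continuous L := continuous_log_one_add_sq_div hs
  have hL0 : ∀ z, 0 ≤ L z := log_one_add_sq_div_nonneg hs
  have hgform : ∀ z, g z = (√(2 * Real.pi * V_g))⁻¹ * Real.exp (-(1 / (2 * V_g)) * z ^ 2) := by
    intro z
    simp only [g, gaussianPDF, add_sub_cancel_right]
    rw [div_eq_inv_mul]
    ring_nf
  have hgc : Continuous g := by
    simp only [funext hgform]
    fun_prop
  have hgpos : ∀ z, 0 ≤ g z := fun z => by rw [hgform]; positivity
  have ig : Integrable g := by
    simp only [funext hgform]
    exact (integrable_exp_neg_mul_sq hk).const_mul _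
  have hg1 : ∫ z, g z = 1 := by
    simp only [hgform]
    rw [integral_const_mul, integral_gaussian,
      show Real.pi / (1 / (2 * V_g)) = 2 * Real.pi * V_g by field_simp]
    exact inv_mul_cancel₀ (by positivity)
  have igL : Integrable fun z => L z * g z := by
    have h := ((integrable_rpow_mul_exp_neg_mul_sq hk (s := 2) (by norm_num)).const_mul
      ((√(2 * Real.pi * V_g))⁻¹ * (2 * σ)⁻¹))
    refine h.mono' (by fun_prop) (.of_forall fun z => ?_)
    rw [Real.norm_eq_abs, abs_of_nonneg (mul_nonneg (hL0 z) (hgpos z)), Real.rpow_two]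
    have hle : L z ≤ z ^ 2 / (2 * σ) := by
      have := Real.log_le_sub_one_of_pos (show 0 < 1 + z ^ 2 / (2 * σ) by positivity)
      simp only [L]
      linarith
    refine (mul_le_mul_of_nonneg_right hle (hgpos z)).trans_eq ?_
    rw [hgform]
    ring
  have igw : Integrable fun z => Real.exp (-L z) * g z := by
    refine ig.mono' (by fun_prop) (.of_forall fun z => ?_)
    rw [Real.norm_eq_abs, abs_of_nonneg (mul_nonneg (Real.exp_pos _).le (hgpos z))]
    exact mul_le_of_le_one_left (hgpos z) (Real.exp_le_one_iff.2 (by linarith [hL0 z]))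
  rw [← integral_add_right_eq_self _ m_g] at hG hH
  simp only [add_sub_cancel_right] at hG hH
  have hgL : ∫ z, L z * g z = digamma (α + 1 / 2) - digamma α := by
    simp only [L, g]
    linarith
  have hgw : (α + 1 / 2) * ∫ z, Real.exp (-L z) * g z = α := by
    have h : ∀ z, (α * z ^ 2 - σ) / (2 * σ + z ^ 2) * gaussianPDF m_g V_g (z + m_g) =
        α * g z - (α + 1 / 2) * (Real.exp (-L z) * g z) := by
      intro z
      have h1 : 0 < 1 + z ^ 2 / (2 * σ) := by positivity
      have h2 : 0 < 2 * σ + z ^ 2 := by positivity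
      have h3 : Real.exp (-L z) = 2 * σ / (2 * σ + z ^ 2) := by
        simp only [L]
        rw [Real.exp_neg, Real.exp_log h1]
        field_simp
      rw [h3]
      simp only [g]
      field_simp
      ring
    simp only [h] at hH
    rw [integral_sub (ig.const_mul _) (igw.const_mul _), integral_const_mul, integral_const_mul,
      hg1] at hH
    linarith
  set N := ∫ z, Real.exp (-((α + 1 / 2) * L z)) with hN
  have hNform : N = _ := integral_exp_neg_mul_log_one_add_sq_div hs
    (show 1 / 2 < α + 1 / 2 by linarith)
  rw [add_sub_cancel_right] at hNform
  have hΓ := Real.Gamma_pos_of_pos hα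
  have hΓ' := Real.Gamma_pos_of_pos (show 0 < α + 1 / 2 by linarith)
  have hNpos : 0 < N := by rw [hNform]; positivity
  let t : ℝ → ℝ := fun z => N⁻¹ * Real.exp (-((α + 1 / 2) * L z))
  have hwt : ∀ z, Real.exp (-L z) * t z = N⁻¹ * Real.exp (-((α + 1 + 1 / 2) * L z)) := by
    intro z
    simp only [t]
    rw [mul_left_comm, ← Real.exp_add]
    ring_nf
  have hLt : ∀ z, L z * t z = N⁻¹ * (L z * Real.exp (-((α + 1 / 2) * L z))) := fun z =>
    mul_left_comm _ _ _
  refine gaussian_student_moments_ne (g := g) (t := t) (p := α + 1 / 2)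
    (c := Real.log (√(2 * Real.pi * V_g))⁻¹) (d := Real.log N⁻¹) hs hk ?_ ?_ ig ?_ igL ?_ igw ?_
    ?_ ?_ ?_
  · intro z
    rw [hgform, sub_eq_add_neg, Real.exp_add, Real.exp_log (by positivity), neg_mul]
  · intro z
    rw [sub_eq_add_neg, Real.exp_add, Real.exp_log (by positivity)]
  · exact (integrable_exp_neg_mul_log_one_add_sq_div hs (by linarith)).const_mul _
  · exact ((integrable_log_one_add_sq_div_mul_exp hs
      (show 1 / 2 < α + 1 / 2 by linarith)).const_mul N⁻¹).congr
      (.of_forall fun z => (hLt z).symm)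
  · exact ((integrable_exp_neg_mul_log_one_add_sq_div hs
      (show 1 / 2 < α + 1 + 1 / 2 by linarith)).const_mul N⁻¹).congr
      (.of_forall fun z => (hwt z).symm)
  · rw [hg1, integral_const_mul, ← hN, inv_mul_cancel₀ hNpos.ne']
  · change ∫ z, L z * g z = ∫ z, L z * t z
    simp only [hLt]
    rw [integral_const_mul, hgL, integral_log_one_add_sq_div_mul_exp hs hα, ← hN]
    field_simp
  · change ∫ z, Real.exp (-L z) * g z = ∫ z, Real.exp (-L z) * t z
    simp only [hwt]
    rw [integral_const_mul, integral_exp_neg_mul_log_one_add_sq_div hs (by linarith), hNform,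
      add_sub_cancel_right, Real.Gamma_add_one hα.ne', show α + 1 + 1 / 2 = α + 1 / 2 + 1 by ring,
      Real.Gamma_add_one (by positivity)]
    rw [eq_div_of_mul_eq (by positivity) ((mul_comm _ _).trans hgw)]
    field_simp
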